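/- arXiv:2202.04240 — 2 statements merged into one kernel-verified Lean document; each statement's English description precedes it below -/
import Mathlib

section
/- For any vector X ∈ ℝ⁷, (X⌟φ₀) ∧ ψ₀ = 3⋆X♭, where X♭ is the 1-form metric-dual to X. -/
/-!
Coefficient model of differential forms on ℝ⁷ with the Euclidean metric:
a `k`-form is represented by its (fully alternating) coefficient tensor
`(Fin k → Fin 7) → ℝ`.  We define the wedge product, Hodge star,
interior product, the standard volume form, and the G₂ three-form `φ₀`.

Note: the operator defining the decomposition Λ² = Λ²₇ ⊕ Λ²₁₄ is
`β ↦ ⋆(φ₀ ∧ β)`, with eigenvalues `2` and `-1` (this is the operator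
written `⋆(ψ ∧ β)` in some references; degree reasons force the 3-form).
-/

namespace G2R7

open scoped BigOperators Classical

noncomputable section

/-- A `k`-form on ℝ⁷, represented by its coefficient tensor. -/
abbrev Form (k : ℕ) : Type := (Fin k → Fin 7) → ℝ

/-- The coefficient tensor is fully alternating. -/
def IsAlt {k : ℕ} (α : Form k) : Prop :=
  (∀ i : Fin k → Fin 7, ¬ Function.Injective i → α i = 0) ∧
  (∀ (σ : Equiv.Perm (Fin k)) (i : Fin k → Fin 7),
      α (i ∘ σ) = ((Equiv.Perm.sign σ : ℤ) : ℝ) * α i)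

/-- Wedge product of forms (determinant convention). -/
def wedge {k l : ℕ} (α : Form k) (β : Form l) : Form (k + l) := fun i =>
  (1 / ((k.factorial : ℝ) * (l.factorial : ℝ))) *
    ∑ σ : Equiv.Perm (Fin (k + l)),
      ((Equiv.Perm.sign σ : ℤ) : ℝ)
        * α (fun a => i (σ (Fin.castAdd l a)))
        * β (fun b => i (σ (Fin.natAdd k b)))

/-- Levi-Civita symbol on 7 indices. -/
def eps (f : Fin 7 → Fin 7) : ℝ :=
  if h : Function.Bijective f then ((Equiv.Perm.sign (Equiv.ofBijective f h) : ℤ) : ℝ)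
  else 0

/-- Hodge star with respect to the Euclidean metric and standard orientation. -/
def hstar {k : ℕ} (α : Form k) : Form (7 - k) := fun j =>
  (1 / (k.factorial : ℝ)) *
    ∑ i : Fin k → Fin 7, α i *
      eps (fun t => if h : (t : ℕ) < k then i ⟨t, h⟩
        else if h' : (t : ℕ) - k < 7 - k then j ⟨(t : ℕ) - k, h'⟩ else t)

/-- Pointwise inner product of `k`-forms induced by the Euclidean metric
(coordinate wedge monomials are orthonormal). -/
def ipt {k : ℕ} (α β : Form k) : ℝ :=
  (1 / (k.factorial : ℝ)) * ∑ i : Fin k → Fin 7, α i * β i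

/-- Pointwise squared norm. -/
def normSq {k : ℕ} (α : Form k) : ℝ := ipt α α

/-- Standard volume form dx¹∧⋯∧dx⁷. -/
def vol : Form 7 := eps

/-- Coordinate 1-forms dxᵃ (0-indexed). -/
def dx (a : Fin 7) : Form 1 := fun i => if i 0 = a then 1 else 0

/-- dxᵃ ∧ dxᵇ ∧ dxᶜ. -/
def dx3 (a b c : Fin 7) : Form 3 := wedge (wedge (dx a) (dx b)) (dx c)

/-- The standard G₂ three-form
`φ₀ = dx¹²³ − dx¹⁶⁷ − dx⁵²⁷ − dx⁵⁶³ + dx⁴¹⁵ + dx⁴²⁶ + dx⁴³⁷` (0-indexed below). -/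
def φ₀ : Form 3 :=
  dx3 0 1 2 - dx3 0 5 6 - dx3 4 1 6 - dx3 4 5 2 + dx3 3 0 4 + dx3 3 1 5 + dx3 3 2 6

/-- The G₂ four-form ψ₀ = ⋆φ₀. -/
def ψ₀ : Form 4 := hstar φ₀

/-- Interior product X ⌟ α. -/
def iprod {k : ℕ} (X : Fin 7 → ℝ) (α : Form (k + 1)) : Form k := fun i =>
  ∑ a : Fin 7, X a * α (Fin.cons a i)

/-- Metric dual 1-form X♭ of a vector X. -/
def flat (X : Fin 7 → ℝ) : Form 1 := fun i => X (i 0)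

/-- The operator β ↦ ⋆(φ₀ ∧ β) on 2-forms whose eigenspaces give Λ²₇ and Λ²₁₄. -/
def Lop (β : Form 2) : Form 2 := hstar (wedge φ₀ β)

/-- β lies in the 7-dimensional component Λ²₇ (eigenvalue 2). -/
def in7 (β : Form 2) : Prop := Lop β = (2 : ℝ) • β

/-- β lies in the 14-dimensional component Λ²₁₄ (eigenvalue −1). -/
def in14 (β : Form 2) : Prop := Lop β = -β

end
end G2R7

namespace G2R7

open Equiv Finset

/-! ### The Levi-Civita symbol -/

theorem eps_comp_perm (f : Fin 7 → Fin 7) (ρ : Perm (Fin 7)) :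
    eps (f ∘ ρ) = ((Perm.sign ρ : ℤ) : ℝ) * eps f := by
  unfold eps
  by_cases h : Function.Bijective f
  · have h' : Function.Bijective (f ∘ ρ) := h.comp ρ.bijective
    rw [dif_pos h, dif_pos h']
    have : Equiv.ofBijective (f ∘ ρ) h' = Equiv.ofBijective f h * ρ := by
      ext; rfl
    rw [this, Perm.sign_mul]
    push_cast
    ring
  · have h' : ¬ Function.Bijective (f ∘ ρ) := fun h' => h (by
      simpa [Function.comp_assoc] using h'.comp ρ.symm.bijective)
    rw [dif_neg h, dif_neg h', mul_zero]

/-- The sign of the comparison of `x` with `y`, decided on natural numbers. -/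
def cmpSign (x y : Fin 7) : ℤ :=
  bif Nat.blt x y then 1 else bif Nat.beq x y then 0 else -1

/-- An integer-valued computable form of the Levi-Civita symbol. -/
def epsInt (f : Fin 7 → Fin 7) : ℤ :=
  cmpSign (f 0) (f 1) * cmpSign (f 0) (f 2) * cmpSign (f 0) (f 3) * cmpSign (f 0) (f 4) *
    cmpSign (f 0) (f 5) * cmpSign (f 0) (f 6) * cmpSign (f 1) (f 2) * cmpSign (f 1) (f 3) *
    cmpSign (f 1) (f 4) * cmpSign (f 1) (f 5) * cmpSign (f 1) (f 6) * cmpSign (f 2) (f 3) *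
    cmpSign (f 2) (f 4) * cmpSign (f 2) (f 5) * cmpSign (f 2) (f 6) * cmpSign (f 3) (f 4) *
    cmpSign (f 3) (f 5) * cmpSign (f 3) (f 6) * cmpSign (f 4) (f 5) * cmpSign (f 4) (f 6) *
    cmpSign (f 5) (f 6)

theorem cmpSign_eq (x y : Fin 7) :
    cmpSign x y = if x < y then 1 else if x = y then 0 else -1 := by
  revert x y
  decide

theorem epsInt_eq_prod (f : Fin 7 → Fin 7) :
    epsInt f = ∏ i : Fin 7, ∏ j ∈ Ioi i, cmpSign (f i) (f j) := by
  have hI : ∀ i : Fin 7, Ioi i = univ.filter (i < ·) := fun i => by ext; simp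
  simp only [epsInt, hI, prod_filter]
  simp [Fin.prod_univ_succ, mul_assoc]

theorem eps_eq_epsInt (f : Fin 7 → Fin 7) : eps f = (epsInt f : ℝ) := by
  rw [epsInt_eq_prod]
  unfold eps
  split_ifs with h
  · rw [Perm.sign_eq_prod_prod_Ioi]
    push_cast
    refine prod_congr rfl fun i _ => prod_congr rfl fun j hj => ?_
    have hne : f i ≠ f j := fun e => (mem_Ioi.1 hj).ne (h.1 e)
    simp only [Equiv.ofBijective_apply, cmpSign_eq, if_neg hne]
    split_ifs <;> simp
  · have hi : ¬ Function.Injective f := fun hi => h (Finite.injective_iff_bijective.1 hi)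
    obtain ⟨a, b, hab, hne⟩ := Function.not_injective_iff.1 hi
    have key : ∀ a b : Fin 7, a < b → f a = f b →
        ∏ i : Fin 7, ∏ j ∈ Ioi i, cmpSign (f i) (f j) = 0 := fun a b hlt e =>
      prod_eq_zero (mem_univ a) (prod_eq_zero (mem_Ioi.2 hlt) (by simp [cmpSign_eq, e]))
    rcases lt_or_gt_of_ne hne with hlt | hlt
    · rw [key a b hlt hab, Int.cast_zero]
    · rw [key b a hlt hab.symm, Int.cast_zero]

/-! ### Forms determined by their values on increasing multi-indices -/

/-- Equivariance of a coefficient tensor under permutation of its indices. -/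
def PermEquivariant {k : ℕ} (α : Form k) : Prop :=
  ∀ (σ : Perm (Fin k)) (i : Fin k → Fin 7), α (i ∘ σ) = ((Perm.sign σ : ℤ) : ℝ) * α i

theorem PermEquivariant.eq_zero {k : ℕ} {α : Form k} (hα : PermEquivariant α)
    {i : Fin k → Fin 7} (hi : ¬ Function.Injective i) : α i = 0 := by
  obtain ⟨a, b, hab, hne⟩ := Function.not_injective_iff.1 hi
  have h := hα (swap a b) i
  have hc : i ∘ swap a b = i := by
    funext x
    rcases eq_or_ne x a with rfl | hxa
    · simp [hab]
    rcases eq_or_ne x b with rfl | hxb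
    · simp [hab]
    simp [swap_apply_of_ne_of_ne hxa hxb]
  rw [hc, Perm.sign_swap hne] at h
  push_cast at h
  linarith

theorem exists_succAbove_comp_perm {n : ℕ} {i : Fin n → Fin (n + 1)}
    (hi : Function.Injective i) :
    ∃ (c : Fin (n + 1)) (τ : Perm (Fin n)), i = c.succAbove ∘ τ := by
  have hs : ¬ Function.Surjective i := fun hs => by
    have := Fintype.card_le_of_surjective i hs
    simp at this
  obtain ⟨c, hc⟩ := not_forall.1 hs
  have hc' : ∀ x, ∃ y, c.succAbove y = i x := fun x =>
    Fin.exists_succAbove_eq fun e => hc ⟨x, e⟩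
  choose t ht using hc'
  have htinj : Function.Injective t := fun x y e => hi (by rw [← ht, ← ht, e])
  exact ⟨c, Equiv.ofBijective t (Finite.injective_iff_bijective.1 htinj),
    funext fun x => (ht x).symm⟩

theorem PermEquivariant.ext {α β : Form 6} (hα : PermEquivariant α) (hβ : PermEquivariant β)
    (h : ∀ c : Fin 7, α c.succAbove = β c.succAbove) : α = β := by
  funext i
  by_cases hi : Function.Injective i
  · obtain ⟨c, τ, rfl⟩ := exists_succAbove_comp_perm hi
    rw [hα, hβ, h]
  · rw [hα.eq_zero hi, hβ.eq_zero hi]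

theorem permEquivariant_wedge {k l : ℕ} (α : Form k) (β : Form l) :
    PermEquivariant (wedge α β) := by
  intro τ i
  unfold wedge
  rw [mul_left_comm]
  congr 1
  rw [mul_sum]
  refine Fintype.sum_equiv (Equiv.mulLeft τ) _ _ fun σ => ?_
  have hsq : ((Perm.sign τ : ℤ) : ℝ) * ((Perm.sign τ : ℤ) : ℝ) = 1 := by
    exact_mod_cast Int.units_coe_mul_self (Perm.sign τ)
  simp only [Equiv.coe_mulLeft, Perm.sign_mul, Perm.mul_apply, Function.comp_apply]
  push_cast
  linear_combination (-((Perm.sign σ : ℤ) : ℝ) * α (fun a => i (τ (σ (Fin.castAdd l a))))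
    * β (fun b => i (τ (σ (Fin.natAdd k b))))) * hsq

/-! ### Hodge star -/

theorem hstar_three_apply (α : Form 3) (j : Fin 4 → Fin 7) :
    hstar α j = (1 / 6) * ∑ i : Fin 3 → Fin 7, α i * eps (Fin.append i j) := by
  unfold hstar
  have h3 : (1 / ((3 : ℕ).factorial : ℝ)) = 1 / 6 := by norm_num [Nat.factorial]
  rw [h3]
  congr 1
  refine sum_congr rfl fun i _ => ?_
  congr 2
  funext t
  fin_cases t <;> rfl

theorem hstar_one_apply (α : Form 1) (j : Fin 6 → Fin 7) :
    hstar α j = ∑ i : Fin 1 → Fin 7, α i * eps (Fin.append i j) := by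
  unfold hstar
  simp only [Nat.factorial, Nat.cast_one, mul_one, div_one, one_mul]
  refine sum_congr rfl fun i _ => ?_
  congr 2
  funext t
  fin_cases t <;> rfl

theorem append_comp_perm {k l : ℕ} {A : Type*} (i : Fin k → A) (j : Fin l → A)
    (σ : Perm (Fin k)) (τ : Perm (Fin l)) :
    Fin.append (i ∘ σ) (j ∘ τ) =
      Fin.append i j ∘ finSumFinEquiv.permCongr (Equiv.sumCongr σ τ) := by
  funext t
  refine Fin.addCases (fun x => ?_) (fun x => ?_) t <;>
    simp [Equiv.permCongr_apply]

theorem sign_permCongr_sumCongr {k l : ℕ} (σ : Perm (Fin k)) (τ : Perm (Fin l)) :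
    Perm.sign (finSumFinEquiv.permCongr (Equiv.sumCongr σ τ)) =
      Perm.sign σ * Perm.sign τ := by
  rw [Perm.sign_permCongr]
  exact Perm.sign_sumCongr σ τ

theorem permEquivariant_hstar_three (α : Form 3) :
    PermEquivariant (k := 4) (hstar α) := by
  intro τ j
  rw [hstar_three_apply, hstar_three_apply, mul_left_comm]
  congr 1
  rw [mul_sum]
  refine sum_congr rfl fun i _ => ?_
  have h := append_comp_perm i j 1 τ
  rw [Perm.coe_one, Function.comp_id] at h
  rw [h]
  erw [eps_comp_perm, sign_permCongr_sumCongr]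
  simp only [Perm.sign_one, one_mul]
  ring

theorem permEquivariant_hstar_one (α : Form 1) :
    PermEquivariant (k := 6) (hstar α) := by
  intro τ j
  rw [hstar_one_apply, hstar_one_apply, mul_sum]
  refine sum_congr rfl fun i _ => ?_
  have h := append_comp_perm i j 1 τ
  rw [Perm.coe_one, Function.comp_id] at h
  rw [h]
  erw [eps_comp_perm, sign_permCongr_sumCongr]
  simp only [Perm.sign_one, one_mul]
  ring

/-! ### The coordinate three-forms -/

/-- The coefficient of `dxᵃ ∧ dxᵇ ∧ dxᶜ` at `(x, y, z)`, as an integer. -/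
def dx3Int (a b c x y z : Fin 7) : ℤ :=
  ∑ σ : Perm (Fin 3), (Perm.sign σ : ℤ) *
    if ![x, y, z] ∘ σ = ![a, b, c] then 1 else 0

theorem dx3_apply (a b c : Fin 7) (i : Fin 3 → Fin 7) :
    dx3 a b c i = ∑ σ : Perm (Fin 3), ((Perm.sign σ : ℤ) : ℝ) *
      if i ∘ σ = ![a, b, c] then 1 else 0 := by
  have h2 : ∀ g : Fin 2 → Fin 7, wedge (dx a) (dx b) g =
      (if g 0 = a then 1 else 0) * (if g 1 = b then 1 else 0)
        - (if g 1 = a then 1 else 0) * (if g 0 = b then 1 else 0) := by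
    intro g
    have hu : (univ : Finset (Perm (Fin 2))) = {1, swap 0 1} := by decide
    simp only [wedge, dx]
    erw [hu, sum_pair (by decide)]
    simp [Fin.castAdd, Fin.natAdd]
    split_ifs <;> ring
  have hG : ∀ σ : Perm (Fin 3), (if i ∘ σ = ![a, b, c] then (1 : ℝ) else 0) =
      (if i (σ 0) = a then 1 else 0) * (if i (σ 1) = b then 1 else 0) *
        (if i (σ 2) = c then 1 else 0) := by
    intro σ
    have : i ∘ σ = ![a, b, c] ↔ i (σ 0) = a ∧ i (σ 1) = b ∧ i (σ 2) = c := by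
      simp [funext_iff, Fin.forall_fin_succ]
    simp only [this, ite_and]
    split_ifs <;> simp
  simp only [hG]
  obtain ⟨G, hGd⟩ : ∃ G : Perm (Fin 3) → ℝ, ∀ σ, G σ = ((Perm.sign σ : ℤ) : ℝ) *
      ((if i (σ 0) = a then 1 else 0) * (if i (σ 1) = b then 1 else 0) *
        (if i (σ 2) = c then 1 else 0)) := ⟨_, fun _ => rfl⟩
  have hdx : dx3 a b c i =
      (1 / 2) * ∑ σ : Perm (Fin 3), (G σ + G (Equiv.mulRight (swap 0 1) σ)) := by
    have hfac : 1 / (((1 + 1 : ℕ).factorial : ℝ) * ((1 : ℕ).factorial : ℝ)) = 1 / 2 := by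
      norm_num [Nat.factorial]
    unfold dx3
    rw [wedge, hfac]
    congr 1
    refine sum_congr rfl fun σ _ => ?_
    erw [h2]
    have hs : Perm.sign (σ * swap (0 : Fin 3) 1) = -Perm.sign σ := by
      rw [Perm.sign_mul, Perm.sign_swap (by decide), mul_neg_one]
    have e0 : (σ * swap (0 : Fin 3) 1) 0 = σ 1 := by simp
    have e1 : (σ * swap (0 : Fin 3) 1) 1 = σ 0 := by simp
    have e2 : (σ * swap (0 : Fin 3) 1) 2 = σ 2 := by
      rw [Perm.mul_apply, swap_apply_of_ne_of_ne (by decide) (by decide)]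
    rw [hGd, hGd, Equiv.coe_mulRight, hs, e0, e1, e2]
    push_cast
    have hd : dx c (fun t => i (σ (Fin.natAdd (1 + 1) t))) =
        if i (σ 2) = c then 1 else 0 := rfl
    rw [hd]
    change _ * ((if i (σ 0) = a then 1 else 0) * (if i (σ 1) = b then 1 else 0)
        - (if i (σ 1) = a then 1 else 0) * (if i (σ 0) = b then 1 else 0)) * _ = _
    ring
  rw [hdx, sum_add_distrib, Equiv.sum_comp (Equiv.mulRight (swap 0 1)) G]
  simp only [hGd]
  ring

theorem hstar_dx3_apply (a b c : Fin 7) (j : Fin 4 → Fin 7) :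
    hstar (dx3 a b c) j = eps (Fin.append ![a, b, c] j) := by
  rw [hstar_three_apply]
  simp only [dx3_apply, sum_mul]
  rw [sum_comm]
  have key : ∀ σ : Perm (Fin 3), ∑ i : Fin 3 → Fin 7,
      ((Perm.sign σ : ℤ) : ℝ) * (if i ∘ σ = ![a, b, c] then 1 else 0) *
        eps (Fin.append i j) = eps (Fin.append ![a, b, c] j) := by
    intro σ
    rw [Fintype.sum_eq_single (![a, b, c] ∘ σ.symm)]
    · have h := append_comp_perm ![a, b, c] j σ.symm 1
      rw [Perm.coe_one, Function.comp_id] at h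
      rw [h]
      erw [eps_comp_perm, sign_permCongr_sumCongr]
      have hsq : ((Perm.sign σ : ℤ) : ℝ) * ((Perm.sign σ : ℤ) : ℝ) = 1 := by
        exact_mod_cast Int.units_coe_mul_self (Perm.sign σ)
      have hc : (![a, b, c] ∘ σ.symm) ∘ σ = ![a, b, c] := by
        funext x; simp
      rw [if_pos hc, Perm.sign_symm, Perm.sign_one]
      simp only [mul_one]
      linear_combination (eps (Fin.append ![a, b, c] j)) * hsq
    · intro i hi
      rw [if_neg, mul_zero, zero_mul]
      rintro h
      exact hi (by rw [← h]; funext x; simp)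
  rw [sum_congr rfl fun σ _ => key σ]
  simp [Fintype.card_perm, Nat.factorial]

theorem sum_sign_smul_succ {n : ℕ} {A : Type*} (F : (Fin (n + 1) → A) → ℝ)
    (f : Fin (n + 1) → A) :
    ∑ σ : Perm (Fin (n + 1)), ((Perm.sign σ : ℤ) : ℝ) * F (f ∘ σ) =
      ∑ p : Fin (n + 1), (if p = 0 then 1 else -1) *
        ∑ e : Perm (Fin n), ((Perm.sign e : ℤ) : ℝ) *
          F (Fin.cons (f p) ((fun x => f (swap 0 p x.succ)) ∘ e)) := by
  rw [← Equiv.sum_comp Perm.decomposeFin.symm, Fintype.sum_prod_type]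
  refine sum_congr rfl fun p _ => ?_
  rw [mul_sum]
  refine sum_congr rfl fun e _ => ?_
  have : f ∘ (Perm.decomposeFin.symm (p, e)) =
      Fin.cons (f p) ((fun x => f (swap 0 p x.succ)) ∘ e) := by
    funext x
    refine Fin.cases ?_ (fun x => ?_) x <;> simp
  rw [this, Perm.decomposeFin.symm_sign]
  split_ifs <;> simp

theorem wedge_two_four_apply (α : Form 2) {β : Form 4} (hβ : PermEquivariant β)
    (f : Fin 6 → Fin 7) :
    wedge α β f = (1 / 2) * ∑ p : Fin 6, ∑ q : Fin 5,
      (if p = 0 then 1 else -1) * (if q = 0 then 1 else -1) *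
        (α ![f p, f (swap 0 p q.succ)] *
          β (fun x => f (swap 0 p (swap 0 q x.succ).succ))) := by
  obtain ⟨F, hF⟩ : ∃ F : (Fin 6 → Fin 7) → ℝ, ∀ g, F g =
      α (fun a => g (Fin.castAdd 4 a)) * β (fun b => g (Fin.natAdd 2 b)) :=
    ⟨_, fun _ => rfl⟩
  have hw : wedge α β f =
      (1 / 48) * ∑ σ : Perm (Fin 6), ((Perm.sign σ : ℤ) : ℝ) * F (f ∘ σ) := by
    have h48 : 1 / (((2 : ℕ).factorial : ℝ) * ((4 : ℕ).factorial : ℝ)) = 1 / 48 := by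
      norm_num [Nat.factorial]
    unfold wedge
    rw [h48]
    congr 1
    exact sum_congr rfl fun σ _ => by rw [mul_assoc, hF]; rfl
  have hp : ∀ p : Fin 6, ∑ e : Perm (Fin 5), ((Perm.sign e : ℤ) : ℝ) *
      F (Fin.cons (f p) ((fun x => f (swap 0 p x.succ)) ∘ e)) =
      24 * ∑ q : Fin 5, (if q = 0 then 1 else -1) *
        (α ![f p, f (swap 0 p q.succ)] *
          β (fun x => f (swap 0 p (swap 0 q x.succ).succ))) := by
    intro p
    rw [sum_sign_smul_succ (fun h : Fin 5 → Fin 7 => F (Fin.cons (f p) h)), mul_sum]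
    refine sum_congr rfl fun q _ => ?_
    have he : ∀ e : Perm (Fin 4), ((Perm.sign e : ℤ) : ℝ) *
        F (Fin.cons (f p) (Fin.cons (f (swap 0 p q.succ))
            ((fun x => f (swap 0 p (swap 0 q x.succ).succ)) ∘ e))) =
        α ![f p, f (swap 0 p q.succ)] *
          β (fun x => f (swap 0 p (swap 0 q x.succ).succ)) := by
      intro e
      have h1 : (fun a : Fin 2 => (Fin.cons (f p) (Fin.cons (f (swap 0 p q.succ))
            ((fun x => f (swap 0 p (swap 0 q x.succ).succ)) ∘ e)) : Fin 6 → Fin 7)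
            (Fin.castAdd 4 a)) = ![f p, f (swap 0 p q.succ)] := by
        funext a; fin_cases a <;> rfl
      have h2 : (fun b : Fin 4 => (Fin.cons (f p) (Fin.cons (f (swap 0 p q.succ))
            ((fun x => f (swap 0 p (swap 0 q x.succ).succ)) ∘ e)) : Fin 6 → Fin 7)
            (Fin.natAdd 2 b)) =
          (fun x => f (swap 0 p (swap 0 q x.succ).succ)) ∘ e := by
        funext a; fin_cases a <;> rfl
      have hsq : ((Perm.sign e : ℤ) : ℝ) * ((Perm.sign e : ℤ) : ℝ) = 1 := by
        exact_mod_cast Int.units_coe_mul_self (Perm.sign e)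
      rw [hF, h1, h2, hβ]
      linear_combination (α ![f p, f (swap 0 p q.succ)] *
          β (fun x => f (swap 0 p (swap 0 q x.succ).succ))) * hsq
    have hsum := sum_congr (rfl : (univ : Finset (Perm (Fin 4))) = univ) fun e _ => he e
    rw [sum_const, card_univ, Fintype.card_perm, Fintype.card_fin, nsmul_eq_mul] at hsum
    have h24 : ((4 : ℕ).factorial : ℝ) = 24 := by norm_num [Nat.factorial]
    rw [h24] at hsum
    refine (congrArg _ hsum).trans ?_
    ring
  rw [hw, sum_sign_smul_succ F f, sum_congr rfl fun p _ => by rw [hp p], mul_sum, mul_sum]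
  refine sum_congr rfl fun p _ => ?_
  simp only [mul_sum]
  refine sum_congr rfl fun q _ => ?_
  ring

/-! ### Reduction to a finite integer identity -/

/-- The cross product of basis vectors: the entry at `(x, y)` is `±(z + 1)` when
`e_x × e_y = ±e_z`, and `0` when `x = y`. -/
def crossTable : Fin 7 → Fin 7 → ℤ :=
  ![![0, 3, -2, -5, 4, -7, 6], ![-3, 0, 1, -6, 7, 4, -5], ![2, -1, 0, -7, -6, 5, 4],
    ![5, 6, 7, 0, -1, -2, -3], ![-4, -7, 6, 1, 0, -3, 2], ![7, -4, -5, 2, 3, 0, -1],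
    ![-6, 5, -4, 3, -2, 1, 0]]

/-- The coefficients of `φ₀`, as integers. -/
def phiInt (x y z : Fin 7) : ℤ :=
  if crossTable x y = ((z + 1 : ℕ) : ℤ) then 1
  else if crossTable x y = -((z + 1 : ℕ) : ℤ) then -1 else 0

theorem phiInt_eq : ∀ x y z : Fin 7, phiInt x y z =
    dx3Int 0 1 2 x y z - dx3Int 0 5 6 x y z - dx3Int 4 1 6 x y z - dx3Int 4 5 2 x y z
      + dx3Int 3 0 4 x y z + dx3Int 3 1 5 x y z + dx3Int 3 2 6 x y z := by
  decide +kernel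

/-- The coefficients of `ψ₀`, as integers. -/
def psiInt (j : Fin 4 → Fin 7) : ℤ :=
  epsInt (Fin.append ![0, 1, 2] j) - epsInt (Fin.append ![0, 5, 6] j)
    - epsInt (Fin.append ![4, 1, 6] j) - epsInt (Fin.append ![4, 5, 2] j)
    + epsInt (Fin.append ![3, 0, 4] j) + epsInt (Fin.append ![3, 1, 5] j)
    + epsInt (Fin.append ![3, 2, 6] j)

theorem phi_apply (x y z : Fin 7) : φ₀ ![x, y, z] = (phiInt x y z : ℝ) := by
  simp only [φ₀, Pi.add_apply, Pi.sub_apply, dx3_apply, phiInt_eq, dx3Int]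
  push_cast
  rfl

theorem psi_apply (j : Fin 4 → Fin 7) : ψ₀ j = (psiInt j : ℝ) := by
  have h : ψ₀ j = hstar (dx3 0 1 2) j - hstar (dx3 0 5 6) j - hstar (dx3 4 1 6) j
      - hstar (dx3 4 5 2) j + hstar (dx3 3 0 4) j + hstar (dx3 3 1 5) j
      + hstar (dx3 3 2 6) j := by
    rw [ψ₀]
    simp only [hstar_three_apply, φ₀, Pi.add_apply, Pi.sub_apply, add_mul, sub_mul,
      sum_add_distrib, sum_sub_distrib]
    ring
  rw [h]
  simp only [hstar_dx3_apply]
  erw [eps_eq_epsInt, eps_eq_epsInt, eps_eq_epsInt, eps_eq_epsInt, eps_eq_epsInt,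
    eps_eq_epsInt, eps_eq_epsInt]
  simp only [psiInt]
  push_cast
  rfl

theorem sum_phiInt_mul_psiInt : ∀ c a : Fin 7,
    (∑ p : Fin 6, ∑ q : Fin 5, (if p = 0 then 1 else -1) * (if q = 0 then 1 else -1) *
      if phiInt a (c.succAbove p) (c.succAbove (swap 0 p q.succ)) = 0 then 0 else
        phiInt a (c.succAbove p) (c.succAbove (swap 0 p q.succ)) *
        psiInt (fun x => c.succAbove (swap 0 p (swap 0 q x.succ).succ))) =
      6 * epsInt (Fin.append ![a] c.succAbove) := by
  decide +kernel

theorem wedge_iprod_phi_psi_apply (X : Fin 7 → ℝ) (c : Fin 7) :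
    wedge (iprod X φ₀) ψ₀ c.succAbove = 3 * hstar (flat X) c.succAbove := by
  have hi : ∀ x y : Fin 7, iprod X φ₀ ![x, y] = ∑ a, X a * (phiInt a x y : ℝ) :=
    fun x y => sum_congr rfl fun a _ => by rw [← phi_apply]; rfl
  have hr : hstar (flat X) c.succAbove =
      ∑ a, X a * (epsInt (Fin.append ![a] c.succAbove) : ℝ) := by
    rw [hstar_one_apply]
    refine Fintype.sum_equiv (Equiv.funUnique (Fin 1) (Fin 7)) _ _ fun i => ?_
    have hv : ![i 0] = i := by
      funext x; fin_cases x; rfl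
    erw [eps_eq_epsInt]
    rw [Equiv.funUnique_apply]
    erw [hv]
    rfl
  have hψ : PermEquivariant ψ₀ := permEquivariant_hstar_three φ₀
  refine (wedge_two_four_apply _ hψ _).trans ?_
  rw [hr]
  simp only [hi]
  have hsum : ∀ a : Fin 7, (∑ p : Fin 6, ∑ q : Fin 5,
      (if p = 0 then (1 : ℝ) else -1) * (if q = 0 then 1 else -1) *
        ((phiInt a (c.succAbove p) (c.succAbove (swap 0 p q.succ)) : ℝ) *
        ψ₀ (fun x => c.succAbove (swap 0 p (swap 0 q x.succ).succ)))) =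
      6 * (epsInt (Fin.append ![a] c.succAbove) : ℝ) := by
    intro a
    have h := congrArg (Int.cast : ℤ → ℝ) (sum_phiInt_mul_psiInt c a)
    push_cast at h
    rw [← h]
    refine sum_congr rfl fun p _ => sum_congr rfl fun q _ => ?_
    rw [psi_apply]
    congr 1
    split_ifs with h0
    · rw [h0, Int.cast_zero, zero_mul]
    · rfl
  have hcomm : (∑ p : Fin 6, ∑ q : Fin 5,
      (if p = 0 then (1 : ℝ) else -1) * (if q = 0 then 1 else -1) *
        ((∑ a, X a * (phiInt a (c.succAbove p) (c.succAbove (swap 0 p q.succ)) : ℝ)) *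
        ψ₀ (fun x => c.succAbove (swap 0 p (swap 0 q x.succ).succ)))) =
      ∑ a, X a * (6 * (epsInt (Fin.append ![a] c.succAbove) : ℝ)) := by
    simp only [← hsum, mul_sum, sum_mul]
    rw [sum_comm (s := (univ : Finset (Fin 7)))]
    refine sum_congr rfl fun p _ => ?_
    rw [sum_comm (s := (univ : Finset (Fin 7)))]
    refine sum_congr rfl fun q _ => sum_congr rfl fun a _ => ?_
    ring
  refine (congrArg _ hcomm).trans ?_
  rw [mul_sum, mul_sum]
  refine sum_congr rfl fun a _ => ?_
  ring

end G2R7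

open G2R7

/-- for any X ∈ ℝ⁷, (X⌟φ₀) ∧ ψ₀ = 3⋆X♭. -/
theorem stmt5 (X : Fin 7 → ℝ) :
    wedge (iprod X φ₀) ψ₀ = (3 : ℝ) • hstar (flat X) := by
  refine PermEquivariant.ext (permEquivariant_wedge _ _) (fun σ i => ?_)
    (wedge_iprod_phi_psi_apply X)
  have h := permEquivariant_hstar_one (flat X) σ i
  simp only [Pi.smul_apply, smul_eq_mul]
  rw [h]
  ring
end

section
/- For the standard G₂ three-form φ₀ and ψ₀ = ⋆φ₀ on ℝ⁷, the map i: S²₀(ℝ⁷) → Λ³(ℝ⁷)* defined on symmetric products by i(α∘β) = α∧⋆(β∧⋆φ₀) + β∧⋆(α∧⋆φ₀) (extended linearly) maps the 27-dimensional space of traceless symmetric bilinear forms injectively into Λ³, and its image is exactly Λ³₂₇ = {γ : γ∧φ₀ = 0 and γ∧ψ₀ = 0}. -/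
open G2R7

/-- The map i : S²₀(ℝ⁷) → Λ³, defined on symmetric products of 1-forms by
i(α∘β) = α∧⋆(β∧⋆φ₀) + β∧⋆(α∧⋆φ₀) and extended linearly: for
h = ∑ h_{ab} dxᵃ∘dxᵇ we get the sum below. -/
noncomputable def iMap (h : Matrix (Fin 7) (Fin 7) ℝ) : Form 3 :=
  ∑ a : Fin 7, ∑ b : Fin 7, h a b •
    (wedge (dx a) (hstar (wedge (dx b) ψ₀)) + wedge (dx b) (hstar (wedge (dx a) ψ₀)))

namespace G2R7

open Equiv Finset

/-- A tensor that changes by the sign of every permutation of its arguments. -/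
def IsAntisymm {k : ℕ} (F : Form k) : Prop :=
  ∀ (σ : Perm (Fin k)) (i : Fin k → Fin 7), F (i ∘ σ) = ((Perm.sign σ : ℤ) : ℝ) * F i

lemma IsAntisymm.comp_perm {k : ℕ} {F : Form k} (hF : IsAntisymm F) (σ : Perm (Fin k))
    (i : Fin k → Fin 7) : F (i ∘ σ) = ((Perm.sign σ : ℤ) : ℝ) * F i := hF σ i

lemma IsAntisymm.isAlt {k : ℕ} {F : Form k} (hF : IsAntisymm F) : IsAlt F := by
  refine ⟨fun i hi => ?_, hF⟩
  obtain ⟨a, b, hab, hne⟩ : ∃ a b, i a = i b ∧ a ≠ b := by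
    simpa [Function.Injective] using hi
  have h := hF (swap a b) i
  have hi' : i ∘ swap a b = i := by
    funext x
    simp only [Function.comp_apply, swap_apply_def]
    split_ifs with h₁ h₂
    · rw [h₁, hab]
    · rw [h₂, hab]
    · rfl
  rw [hi', Perm.sign_swap hne] at h
  push_cast at h
  linarith

lemma sign_mul_self {n : ℕ} (σ : Perm (Fin n)) :
    ((Perm.sign σ : ℤ) : ℝ) * ((Perm.sign σ : ℤ) : ℝ) = 1 := by
  rcases Int.units_eq_one_or (Perm.sign σ) with h | h <;> simp [h]

/-- The decomposable form `dx^{d 0} ∧ ⋯ ∧ dx^{d (k-1)}`. -/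
def mono {k : ℕ} (d : Fin k → Fin 7) : Form k := fun i =>
  (Matrix.of fun x y => if d x = i y then (1 : ℝ) else 0).det

lemma mono_eq_sum {k : ℕ} (d i : Fin k → Fin 7) :
    mono d i = ∑ σ : Perm (Fin k), ((Perm.sign σ : ℤ) : ℝ) * if d ∘ σ = i then 1 else 0 := by
  rw [mono, Matrix.det_apply']
  refine sum_congr rfl fun σ _ => ?_
  congr 1
  simp only [Matrix.of_apply, prod_ite_zero, prod_const_one, funext_iff, Function.comp_apply,
    mem_univ, true_implies]

lemma mono_comm {k : ℕ} (d i : Fin k → Fin 7) : mono d i = mono i d := by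
  rw [mono, mono, ← Matrix.det_transpose]
  congr 1
  ext x y
  simp [eq_comm]

lemma isAntisymm_mono {k : ℕ} (d : Fin k → Fin 7) : IsAntisymm (mono d) := fun σ i => by
  rw [mono, mono, ← Matrix.det_permute']
  rfl

lemma mono_eq_zero {k : ℕ} {d i : Fin k → Fin 7} (h : ∀ σ : Perm (Fin k), d ∘ σ ≠ i) :
    mono d i = 0 := by
  rw [mono_eq_sum]
  exact sum_eq_zero fun σ _ => by rw [if_neg (h σ), mul_zero]

lemma sum_mono_mul_eq {k : ℕ} (d : Fin k → Fin 7) (A : Form k) :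
    ∑ i, mono d i * A i = ∑ σ : Perm (Fin k), ((Perm.sign σ : ℤ) : ℝ) * A (d ∘ σ) := by
  simp_rw [mono_eq_sum, sum_mul]
  rw [sum_comm]
  refine sum_congr rfl fun σ _ => ?_
  simp

lemma sum_mono_mul {k : ℕ} (d : Fin k → Fin 7) {F : Form k} (hF : IsAntisymm F) :
    ∑ i, mono d i * F i = k.factorial * F d := by
  rw [sum_mono_mul_eq]
  simp_rw [hF.comp_perm, ← mul_assoc, sign_mul_self]
  simp [Fintype.card_perm]

lemma mono_self {k : ℕ} {d : Fin k → Fin 7} (hd : Function.Injective d) : mono d d = 1 := by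
  rw [mono, ← Matrix.det_one (n := Fin k)]
  congr 1
  ext x y
  simp [Matrix.one_apply, hd.eq_iff]

lemma isAntisymm_eps : IsAntisymm (k := 7) eps := fun σ f => by
  unfold eps
  by_cases hf : Function.Bijective f
  · have hfσ : Function.Bijective (f ∘ σ) := hf.comp σ.bijective
    rw [dif_pos hf, dif_pos hfσ]
    have : Equiv.ofBijective _ hfσ = Equiv.ofBijective f hf * σ := by ext x; rfl
    rw [this, Perm.sign_mul]
    push_cast
    ring
  · have hfσ : ¬ Function.Bijective (f ∘ σ) := by
      rwa [Function.Bijective.of_comp_iff _ σ.bijective]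
    rw [dif_neg hf, dif_neg hfσ, mul_zero]

lemma eps_eq_zero {f : Fin 7 → Fin 7} (hf : ¬ Function.Bijective f) : eps f = 0 := dif_neg hf

lemma eps_eq_prod {f : Fin 7 → Fin 7} (hf : Function.Bijective f) :
    eps f = ((∏ j, ∏ i ∈ Iio j, (if f i < f j then 1 else -1 : ℤˣ) : ℤˣ) : ℤ) := by
  rw [eps, dif_pos hf, Perm.sign_eq_prod_prod_Iio]
  rfl

lemma eps_mul_self {f : Fin 7 → Fin 7} (hf : Function.Bijective f) : eps f * eps f = 1 := by
  rw [eps, dif_pos hf, sign_mul_self]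

/-- Concatenation of two index tuples, in the order prescribed by `e`. -/
def join {k l : ℕ} (e : Fin k ⊕ Fin l ≃ Fin 7) (p : Fin k → Fin 7) (j : Fin l → Fin 7) :
    Fin 7 → Fin 7 := Sum.elim p j ∘ e.symm

lemma join_comp {k l : ℕ} (e : Fin k ⊕ Fin l ≃ Fin 7) (p : Fin k → Fin 7)
    (j : Fin l → Fin 7) (σ : Perm (Fin l)) :
    join e p (j ∘ σ) = join e p j ∘ e.permCongr (Perm.sumCongr 1 σ) := by
  funext x
  simp only [join, Function.comp_apply, Equiv.permCongr_apply, Equiv.symm_apply_apply]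
  rcases e.symm x with y | y <;> simp

lemma isAntisymm_eps_join {k l : ℕ} (e : Fin k ⊕ Fin l ≃ Fin 7) (p : Fin k → Fin 7) :
    IsAntisymm fun j : Fin l → Fin 7 => eps (join e p j) := fun σ j => by
  beta_reduce
  rw [join_comp, isAntisymm_eps, Perm.sign_permCongr, Perm.sign_sumCongr, Perm.sign_one, one_mul]

/-- Hodge duality for decomposable forms. -/
lemma eps_join {k l : ℕ} (e : Fin k ⊕ Fin l ≃ Fin 7) {p : Fin k → Fin 7} {d : Fin l → Fin 7}
    (hd : Function.Bijective (join e p d)) (j : Fin l → Fin 7) :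
    eps (join e p j) = eps (join e p d) * mono d j := by
  have bij {q : Fin l → Fin 7} :
      Function.Bijective (join e p q) ↔ Function.Bijective (Sum.elim p q) :=
    Function.Bijective.of_comp_iff _ e.symm.bijective
  rw [bij] at hd
  have hinj : Function.Injective d := hd.1.comp Sum.inr_injective
  by_cases h : ∃ σ : Perm (Fin l), d ∘ σ = j
  · obtain ⟨σ, rfl⟩ := h
    rw [isAntisymm_mono, mono_self hinj, (isAntisymm_eps_join e p).comp_perm σ d]
    ring
  · push Not at h
    rw [mono_eq_zero h, mul_zero]
    refine eps_eq_zero fun hj => ?_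
    rw [bij] at hj
    have hx : ∀ x, ∃ y, d y = j x := fun x => by
      obtain ⟨y | y, hy⟩ := hd.2 (j x)
      · exact absurd (hj.1 (a₁ := Sum.inl y) (a₂ := Sum.inr x) hy) (by simp)
      · exact ⟨y, hy⟩
    choose s hs using hx
    have hsinj : Function.Injective s := fun x y hxy => by
      have : j x = j y := by rw [← hs, ← hs, hxy]
      exact Sum.inr_injective (hj.1 (a₁ := Sum.inr x) (a₂ := Sum.inr y) this)
    exact h (Equiv.ofBijective s (Finite.injective_iff_bijective.1 hsinj)) (funext hs)

lemma mono_id (i : Fin 7 → Fin 7) : mono id i = eps i := by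
  have h := eps_join (Equiv.emptySum (Fin 0) (Fin 7)) (p := Fin.elim0) (d := id)
    Function.bijective_id i
  have hid : eps (join (Equiv.emptySum (Fin 0) (Fin 7)) Fin.elim0 id) = 1 := by
    change eps id = 1
    rw [eps, dif_pos Function.bijective_id]
    have : Equiv.ofBijective id Function.bijective_id = (1 : Perm (Fin 7)) := by ext x; rfl
    simp [this]
  rw [hid, one_mul] at h
  exact h.symm

lemma wedge_apply {k l : ℕ} (α : Form k) (β : Form l) (d : Fin (k + l) → Fin 7) :
    wedge α β d = (1 / ((k.factorial : ℝ) * l.factorial)) *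
      ∑ i, mono d i * (α (fun a => i (Fin.castAdd l a)) * β (fun b => i (Fin.natAdd k b))) := by
  rw [sum_mono_mul_eq, wedge]
  simp only [Function.comp_apply, mul_assoc]

lemma isAntisymm_wedge {k l : ℕ} (α : Form k) (β : Form l) : IsAntisymm (wedge α β) :=
  fun σ i => by
    simp_rw [wedge_apply, mono_comm (i ∘ σ), mono_comm i, (isAntisymm_mono _).comp_perm σ i,
      mul_assoc]
    rw [← mul_sum]
    ring

lemma sum_fin_add {k l : ℕ} (f : (Fin (k + l) → Fin 7) → ℝ) :
    ∑ i, f i = ∑ a : Fin k → Fin 7, ∑ b : Fin l → Fin 7, f (Fin.append a b) := by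
  rw [← (Fin.appendEquiv k l).sum_comp, Fintype.sum_prod_type]
  rfl

lemma wedge_apply' {k l : ℕ} (α : Form k) (β : Form l) (d : Fin (k + l) → Fin 7) :
    wedge α β d = (1 / ((k.factorial : ℝ) * l.factorial)) *
      ∑ a, ∑ b, mono d (Fin.append a b) * (α a * β b) := by
  simp [wedge_apply, sum_fin_add]

lemma sum_wedge_mul {k l : ℕ} (α : Form k) (β : Form l) {G : Form (k + l)} (hG : IsAntisymm G) :
    ∑ i, wedge α β i * G i = ((k + l).factorial / ((k.factorial : ℝ) * l.factorial)) *
      ∑ a, ∑ b, α a * β b * G (Fin.append a b) := by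
  have h (y : Fin (k + l) → Fin 7) (c r : ℝ) :
      ∑ x, c * (mono x y * r) * G x = c * (k + l).factorial * (r * G y) := by
    rw [mul_assoc, mul_left_comm _ r, ← sum_mono_mul y hG, mul_sum, mul_sum]
    exact sum_congr rfl fun x _ => by rw [mono_comm]; ring
  simp_rw [wedge_apply, mul_sum, sum_mul]
  rw [sum_comm]
  simp_rw [h]
  rw [sum_fin_add]
  simp only [Fin.append_left, Fin.append_right, ← mul_sum]
  ring

/-- The index triples of the terms of `φ₀`. -/
def φIdx : Fin 7 → Fin 3 → Fin 7 :=
  ![![0, 1, 2], ![0, 5, 6], ![4, 1, 6], ![4, 5, 2], ![3, 0, 4], ![3, 1, 5], ![3, 2, 6]]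

/-- The coefficients of the terms of `φ₀`. -/
def φSgn : Fin 7 → ℤ := ![1, -1, -1, -1, 1, 1, 1]

/-- The complements of the triples `φIdx`, ordered positively. -/
def ψIdx : Fin 7 → Fin 4 → Fin 7 :=
  ![![3, 4, 5, 6], ![1, 2, 3, 4], ![0, 2, 5, 3], ![0, 1, 3, 6], ![1, 2, 6, 5], ![0, 2, 6, 4],
    ![0, 1, 5, 4]]

lemma append_comp_left {k l : ℕ} (a : Fin k → Fin 7) (b : Fin l → Fin 7) (σ : Perm (Fin k)) :
    Fin.append (a ∘ σ) b =
      Fin.append a b ∘ finSumFinEquiv.permCongr (Perm.sumCongr σ (1 : Perm (Fin l))) := by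
  funext x
  refine Fin.addCases (fun y => ?_) (fun y => ?_) x <;> simp [Equiv.permCongr_apply]

lemma append_comp_right {k l : ℕ} (a : Fin k → Fin 7) (b : Fin l → Fin 7) (σ : Perm (Fin l)) :
    Fin.append a (b ∘ σ) =
      Fin.append a b ∘ finSumFinEquiv.permCongr (Perm.sumCongr (1 : Perm (Fin k)) σ) := by
  funext x
  refine Fin.addCases (fun y => ?_) (fun y => ?_) x <;> simp [Equiv.permCongr_apply]

lemma IsAntisymm.append_left {k l : ℕ} {F : Form (k + l)} (hF : IsAntisymm F)
    (b : Fin l → Fin 7) : IsAntisymm fun a : Fin k → Fin 7 => F (Fin.append a b) := fun σ a => by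
  beta_reduce
  rw [append_comp_left, hF, Perm.sign_permCongr, Perm.sign_sumCongr, Perm.sign_one, mul_one]

lemma IsAntisymm.append_right {k l : ℕ} {F : Form (k + l)} (hF : IsAntisymm F)
    (a : Fin k → Fin 7) : IsAntisymm fun b : Fin l → Fin 7 => F (Fin.append a b) := fun σ b => by
  beta_reduce
  rw [append_comp_right, hF, Perm.sign_permCongr, Perm.sign_sumCongr, Perm.sign_one, one_mul]

lemma wedge_mono {k l : ℕ} (d : Fin k → Fin 7) (e : Fin l → Fin 7) :
    wedge (mono d) (mono e) = mono (Fin.append d e) := by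
  funext i
  have h (a : Fin k → Fin 7) : ∑ b, mono i (Fin.append a b) * (mono d a * mono e b) =
      l.factorial * (mono d a * mono i (Fin.append a e)) := by
    rw [mul_left_comm, ← sum_mono_mul e ((isAntisymm_mono i).append_right a), mul_sum]
    exact sum_congr rfl fun b _ => by ring
  simp_rw [wedge_apply', h]
  rw [← mul_sum, sum_mono_mul d ((isAntisymm_mono i).append_left e), mono_comm]
  field_simp

lemma dx_eq_mono (a : Fin 7) : dx a = mono ![a] := by
  funext i
  simp [dx, mono, eq_comm]

lemma dx3_eq_mono (a b c : Fin 7) : dx3 a b c = mono ![a, b, c] := by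
  rw [dx3, dx_eq_mono, dx_eq_mono, dx_eq_mono, wedge_mono, wedge_mono]
  congr 1
  funext x
  fin_cases x <;> rfl

lemma φ₀_apply (i : Fin 3 → Fin 7) : φ₀ i = ∑ t, (φSgn t : ℝ) * mono (φIdx t) i := by
  simp [φ₀, dx3_eq_mono, Fin.sum_univ_seven, φSgn, φIdx, sub_eq_add_neg]

/-- The splitting of the seven indices into the first `3` and the last `4`. -/
abbrev e34 : Fin 3 ⊕ Fin 4 ≃ Fin 7 := finSumFinEquiv

/-- The splitting of the seven indices into the last `3` and the first `4`. -/
abbrev e43 : Fin 4 ⊕ Fin 3 ≃ Fin 7 := (Equiv.sumComm _ _).trans finSumFinEquiv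

lemma join_e43 (d : Fin 4 → Fin 7) (a : Fin 3 → Fin 7) : join e43 d a = join e34 a d := by
  funext x
  simp only [join, Function.comp_apply]
  fin_cases x <;> rfl

lemma bijective_join_idx : ∀ t, Function.Bijective (join e34 (φIdx t) (ψIdx t)) := by
  simp only [← Finite.injective_iff_bijective]
  decide

lemma eps_join_idx (t : Fin 7) : eps (join e34 (φIdx t) (ψIdx t)) = 1 := by
  rw [eps_eq_prod (bijective_join_idx t)]
  have : ∀ t, ∏ j, ∏ i ∈ Iio j, (if join e34 (φIdx t) (ψIdx t) i < join e34 (φIdx t) (ψIdx t) j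
      then 1 else -1 : ℤˣ) = 1 := by decide
  rw [this]
  simp

lemma eps_join_φIdx (t : Fin 7) (j : Fin 4 → Fin 7) :
    eps (join e34 (φIdx t) j) = mono (ψIdx t) j := by
  rw [eps_join e34 (bijective_join_idx t), eps_join_idx, one_mul]

lemma eps_join_ψIdx (t : Fin 7) (a : Fin 3 → Fin 7) :
    eps (join e34 a (ψIdx t)) = mono (φIdx t) a := by
  have h := bijective_join_idx t
  rw [← join_e43] at h ⊢
  rw [eps_join e43 h, join_e43, eps_join_idx, one_mul]

lemma isAntisymm_φ₀ : IsAntisymm φ₀ := fun σ i => by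
  simp_rw [φ₀_apply, (isAntisymm_mono _).comp_perm σ i, mul_sum]
  exact sum_congr rfl fun t _ => by ring

lemma sum_φ₀_mul {F : Form 3} (hF : IsAntisymm F) :
    ∑ i, φ₀ i * F i = 6 * ∑ t, (φSgn t : ℝ) * F (φIdx t) := by
  simp_rw [φ₀_apply, sum_mul, mul_assoc]
  rw [sum_comm, mul_sum]
  refine sum_congr rfl fun t _ => ?_
  rw [← mul_sum, sum_mono_mul _ hF]
  norm_num [Nat.factorial]
  ring

lemma ψ₀_apply_eps (j : Fin 4 → Fin 7) : ψ₀ j = (1 / 6) * ∑ i, φ₀ i * eps (join e34 i j) := by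
  rw [ψ₀, hstar]
  have hs (i : Fin 3 → Fin 7) : (fun t : Fin 7 => if h : (t : ℕ) < 3 then i ⟨t, h⟩
      else if h' : (t : ℕ) - 3 < 7 - 3 then j ⟨(t : ℕ) - 3, h'⟩ else t) = join e34 i j := by
    funext x
    fin_cases x <;> rfl
  simp only [hs]
  norm_num [Nat.factorial]

lemma ψ₀_apply (j : Fin 4 → Fin 7) : ψ₀ j = ∑ t, (φSgn t : ℝ) * mono (ψIdx t) j := by
  have h : IsAntisymm fun i : Fin 3 → Fin 7 => eps (join e34 i j) := by
    simpa only [join_e43] using isAntisymm_eps_join e43 j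
  rw [ψ₀_apply_eps, sum_φ₀_mul h]
  simp only [eps_join_φIdx]
  ring

/-- The double Hodge star of `φ₀` is `φ₀`. -/
lemma sum_ψ₀_mul_eps (a : Fin 3 → Fin 7) : ∑ j, ψ₀ j * eps (join e34 a j) = 24 * φ₀ a := by
  simp_rw [ψ₀_apply, sum_mul, mul_assoc]
  rw [sum_comm, φ₀_apply, mul_sum]
  refine sum_congr rfl fun t _ => ?_
  rw [← mul_sum, sum_mono_mul _ (isAntisymm_eps_join e34 a), eps_join_ψIdx]
  norm_num [Nat.factorial]
  ring

/-- Contracting a 1-form with `φ₀` is `⋆(β ∧ ⋆φ₀)`. -/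
lemma hstar_wedge_ψ₀ (b : Fin 7) (j : Fin 2 → Fin 7) :
    hstar (wedge (dx b) ψ₀) j = φ₀ (Fin.cons b j) := by
  let e52 : Fin 2 ⊕ Fin 5 ≃ Fin 7 := (Equiv.sumComm _ _).trans finSumFinEquiv
  have hG : IsAntisymm (k := 1 + 4) fun i : Fin 5 → Fin 7 => eps (join e52 j i) :=
    isAntisymm_eps_join e52 j
  have hj (i : Fin 4 → Fin 7) : eps (join e52 j (Fin.append ![b] i)) =
      eps (join e34 (Fin.cons b j) i) := by
    let σ : Perm (Fin 7) := ⟨![0, 3, 4, 5, 6, 1, 2], ![0, 5, 6, 1, 2, 3, 4], by decide, by decide⟩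
    have hσ : join e52 j (Fin.append ![b] i) = join e34 (Fin.cons b j) i ∘ σ := by
      funext x
      fin_cases x <;> rfl
    rw [hσ, isAntisymm_eps.comp_perm σ, show Perm.sign σ = 1 by decide]
    simp
  have h := sum_wedge_mul (dx b) ψ₀ hG
  rw [dx_eq_mono] at h
  simp_rw [mul_assoc, ← mul_sum] at h
  have hF : IsAntisymm fun a : Fin 1 → Fin 7 =>
      ∑ i, ψ₀ i * eps (join e52 j (Fin.append a i)) := fun σ a => by
    simp [Subsingleton.elim σ 1]
  rw [sum_mono_mul _ hF] at h
  simp only [hj, sum_ψ₀_mul_eps, ← dx_eq_mono] at h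
  rw [hstar]
  have hs (i : Fin 5 → Fin 7) : (fun t : Fin 7 => if h : (t : ℕ) < 5 then i ⟨t, h⟩
      else if h' : (t : ℕ) - 5 < 7 - 5 then j ⟨(t : ℕ) - 5, h'⟩ else t) = join e52 j i := by
    funext x
    fin_cases x <;> rfl
  simp only [hs]
  rw [h]
  norm_num [Nat.factorial]
  ring

lemma wedge_ψ₀_eq_zero_iff (γ : Form 3) :
    wedge γ ψ₀ = 0 ↔ ∑ a, φ₀ a * γ a = 0 := by
  have hid : wedge γ ψ₀ id = (1 / 6) * ∑ a, φ₀ a * γ a := by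
    have h (a : Fin 3 → Fin 7) : ∑ b, mono (id : Fin (3 + 4) → Fin 7) (Fin.append a b) * (γ a * ψ₀ b)
        = 24 * (φ₀ a * γ a) := by
      rw [← mul_assoc, ← sum_ψ₀_mul_eps, sum_mul]
      refine sum_congr rfl fun b _ => ?_
      rw [show mono (id : Fin (3 + 4) → Fin 7) (Fin.append a b) = eps (join e34 a b) from ?_]
      · ring
      · refine (mono_id _).trans ?_
        congr 1
        funext x
        fin_cases x <;> rfl
    rw [wedge_apply']
    simp_rw [h]
    rw [← mul_sum]
    norm_num [Nat.factorial]
    ring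
  constructor
  · intro h
    rw [h] at hid
    simpa using hid.symm
  · intro h
    rw [h, mul_zero] at hid
    funext d
    by_cases hd : Function.Injective d
    · have hb : Function.Bijective (d : Fin 7 → Fin 7) := Finite.injective_iff_bijective.1 hd
      have := (isAntisymm_wedge γ ψ₀).comp_perm (Equiv.ofBijective (d : Fin 7 → Fin 7) hb) id
      rw [hid, mul_zero] at this
      exact this
    · exact (isAntisymm_wedge γ ψ₀).isAlt.1 d hd

lemma wedge_φ₀_eq_zero_iff (γ : Form 3) :
    wedge γ φ₀ = 0 ↔ ∀ c, ∑ a, γ a * ψ₀ (Fin.cons c a) = 0 := by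
  let e16 : Fin 1 ⊕ Fin 6 ≃ Fin 7 := finSumFinEquiv
  have hψ (c : Fin 7) (a : Fin 3 → Fin 7) :
      ∑ b, φ₀ b * eps (join e16 ![c] (Fin.append a b)) = 6 * ψ₀ (Fin.cons c a) := by
    rw [ψ₀_apply_eps, ← mul_assoc, show (6 : ℝ) * (1 / 6) = 1 by norm_num, one_mul]
    refine sum_congr rfl fun b _ => ?_
    let σ : Perm (Fin 7) := ⟨![3, 4, 5, 6, 0, 1, 2], ![4, 5, 6, 0, 1, 2, 3], by decide, by decide⟩
    have hσ : join e16 ![c] (Fin.append a b) = join e34 b (Fin.cons c a) ∘ σ := by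
      funext x
      fin_cases x <;> rfl
    rw [hσ, isAntisymm_eps.comp_perm σ, show Perm.sign σ = 1 by decide]
    simp
  have key (c : Fin 7) (d : Fin 6 → Fin 7) (hd : Function.Bijective (join e16 ![c] d)) :
      eps (join e16 ![c] d) * wedge γ φ₀ d = (1 / 6) * ∑ a, γ a * ψ₀ (Fin.cons c a) := by
    have h (a : Fin 3 → Fin 7) : eps (join e16 ![c] d) *
        ∑ b, mono (k := 3 + 3) d (Fin.append a b) * (γ a * φ₀ b) =
          6 * (γ a * ψ₀ (Fin.cons c a)) := by
      rw [mul_left_comm, ← hψ, mul_sum, mul_sum]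
      refine sum_congr rfl fun b _ => ?_
      rw [eps_join e16 hd (Fin.append a b)]
      ring
    rw [wedge_apply', mul_left_comm, mul_sum]
    simp_rw [h]
    rw [← mul_sum]
    norm_num [Nat.factorial]
    ring
  constructor
  · intro h c
    have hd : Function.Bijective (join e16 ![c] (Fin.succAbove c)) := by
      rw [← Finite.injective_iff_bijective]
      revert c
      decide
    have := key c _ hd
    rw [h] at this
    simpa using this.symm
  · intro h
    funext d
    by_cases hd : Function.Injective d
    · obtain ⟨c, hc⟩ : ∃ c, ∀ x, d x ≠ c := by
        by_contra! hs
        have := Fintype.card_le_of_surjective (d : Fin 6 → Fin 7) hs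
        simp at this
      have hb : Function.Bijective (join e16 ![c] d) := by
        rw [← Finite.injective_iff_bijective]
        refine Function.Injective.comp ?_ e16.symm.injective
        refine Function.Injective.sumElim (Function.injective_of_subsingleton _) hd ?_
        intro x y
        rw [Subsingleton.elim x 0]
        exact (hc y).symm
      have := key c d hb
      rw [h, mul_zero] at this
      exact (mul_eq_zero.1 this).resolve_left fun h0 => by simpa [h0] using eps_mul_self hb
    · exact (isAntisymm_wedge γ φ₀).isAlt.1 d hd

/-- Up to sign, the cross product of the basis vectors `q` and `r` is the basis vector
`crossIdx q r`. -/
def crossIdx : Fin 7 → Fin 7 → Fin 7 :=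
  ![![0, 2, 1, 4, 3, 6, 5],
    ![2, 0, 0, 5, 6, 3, 4],
    ![1, 0, 0, 6, 5, 4, 3],
    ![4, 5, 6, 0, 0, 1, 2],
    ![3, 6, 5, 0, 0, 2, 1],
    ![6, 3, 4, 1, 2, 0, 0],
    ![5, 4, 3, 2, 1, 0, 0]]

/-- The sign of the cross product of two basis vectors. -/
def crossSgn : Fin 7 → Fin 7 → ℤ :=
  ![![0, 1, -1, -1, 1, -1, 1],
    ![-1, 0, 1, -1, 1, 1, -1],
    ![1, -1, 0, -1, -1, 1, 1],
    ![1, 1, 1, 0, -1, -1, -1],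
    ![-1, -1, 1, 1, 0, -1, 1],
    ![1, -1, -1, 1, 1, 0, -1],
    ![-1, 1, -1, 1, -1, 1, 0]]

lemma φ₀_cross (b q r : Fin 7) :
    φ₀ ![b, q, r] = if b = crossIdx q r then (crossSgn q r : ℝ) else 0 := by
  have h : ∀ b q r : Fin 7, ∑ t, φSgn t *
      ((if φIdx t 0 = b then 1 else 0) * (if φIdx t 1 = q then 1 else 0) *
          (if φIdx t 2 = r then 1 else 0) -
        (if φIdx t 0 = b then 1 else 0) * (if φIdx t 1 = r then 1 else 0) *
          (if φIdx t 2 = q then 1 else 0) -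
        (if φIdx t 0 = q then 1 else 0) * (if φIdx t 1 = b then 1 else 0) *
          (if φIdx t 2 = r then 1 else 0) +
        (if φIdx t 0 = q then 1 else 0) * (if φIdx t 1 = r then 1 else 0) *
          (if φIdx t 2 = b then 1 else 0) +
        (if φIdx t 0 = r then 1 else 0) * (if φIdx t 1 = b then 1 else 0) *
          (if φIdx t 2 = q then 1 else 0) -
        (if φIdx t 0 = r then 1 else 0) * (if φIdx t 1 = q then 1 else 0) *
          (if φIdx t 2 = b then 1 else 0)) =
      if b = crossIdx q r then crossSgn q r else 0 := by
    decide +kernel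
  have h' := congrArg (Int.cast : ℤ → ℝ) (h b q r)
  push_cast at h'
  rw [← h', φ₀_apply]
  refine sum_congr rfl fun t _ => ?_
  exact congrArg _ (Matrix.det_fin_three _)

lemma mono_cons {l : ℕ} (c : Fin 7) (a : Fin l → Fin 7) (d : Fin (l + 1) → Fin 7) :
    mono d (Fin.cons c a) =
      ∑ m : Fin (l + 1), (-1) ^ (m : ℕ) * (if d m = c then 1 else 0) * mono (d ∘ m.succAbove) a := by
  rw [mono, Matrix.det_succ_column_zero]
  rfl

lemma wedge_dx {X : Form 2} (hX : IsAntisymm X) (a p q r : Fin 7) :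
    wedge (dx a) X ![p, q, r] = (if p = a then X ![q, r] else 0)
      - (if q = a then X ![p, r] else 0) + (if r = a then X ![p, q] else 0) := by
  have h1 (b : Fin 2 → Fin 7) : IsAntisymm fun c : Fin 1 → Fin 7 =>
      mono (k := 1 + 2) ![p, q, r] (Fin.append c b) := (isAntisymm_mono _).append_left b
  have h2 (b : Fin 2 → Fin 7) : ∑ c, mono ![a] c * mono (k := 1 + 2) ![p, q, r] (Fin.append c b) =
      mono ![p, q, r] (Fin.cons a b) := by
    rw [sum_mono_mul _ (h1 b)]
    simp only [Nat.factorial_one, Nat.cast_one, one_mul]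
    congr 1
    funext x
    fin_cases x <;> rfl
  have h3 (u v : Fin 7) : ∑ b, mono ![u, v] b * X b = 2 * X ![u, v] := by
    rw [sum_mono_mul _ hX]
    norm_num
  have h4 : wedge (dx a) X ![p, q, r] = (1 / 2) * ∑ b, mono ![p, q, r] (Fin.cons a b) * X b := by
    rw [wedge_apply', sum_comm, dx_eq_mono]
    simp only [← h2, sum_mul]
    norm_num
    exact sum_congr rfl fun b _ => sum_congr rfl fun c _ => by ring
  have e0 : ![p, q, r] ∘ Fin.succAbove 0 = ![q, r] := by funext x; fin_cases x <;> rfl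
  have e1 : ![p, q, r] ∘ Fin.succAbove 1 = ![p, r] := by funext x; fin_cases x <;> rfl
  have e2 : ![p, q, r] ∘ Fin.succAbove 2 = ![p, q] := by funext x; fin_cases x <;> rfl
  have h5 (b : Fin 2 → Fin 7) : mono ![p, q, r] (Fin.cons a b) =
      (if p = a then 1 else 0) * mono ![q, r] b - (if q = a then 1 else 0) * mono ![p, r] b +
        (if r = a then 1 else 0) * mono ![p, q] b := by
    refine (mono_cons a b ![p, q, r]).trans ?_
    rw [Fin.sum_univ_three, e0, e1, e2]
    change (-1) ^ 0 * (if p = a then 1 else 0) * _ + (-1) ^ 1 * (if q = a then 1 else 0) * _ +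
      (-1) ^ 2 * (if r = a then 1 else 0) * _ = _
    ring
  have h6 : ∑ b, mono ![p, q, r] (Fin.cons a b) * X b =
      (if p = a then 1 else 0) * (2 * X ![q, r]) - (if q = a then 1 else 0) * (2 * X ![p, r]) +
        (if r = a then 1 else 0) * (2 * X ![p, q]) := by
    simp only [← h3, mul_sum, ← sum_sub_distrib, ← sum_add_distrib]
    exact sum_congr rfl fun b _ => by rw [h5]; ring
  rw [h4, h6]
  split_ifs <;> ring

lemma wedge_dx_hstar (a b p q r : Fin 7) :
    wedge (dx a) (hstar (wedge (dx b) ψ₀)) ![p, q, r] = (if p = a then φ₀ ![b, q, r] else 0)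
      - (if q = a then φ₀ ![b, p, r] else 0) + (if r = a then φ₀ ![b, p, q] else 0) := by
  have hX : (hstar (wedge (dx b) ψ₀) : Form 2) = fun j => φ₀ (Fin.cons b j) :=
    funext (hstar_wedge_ψ₀ b)
  have hX' : IsAntisymm (hstar (wedge (dx b) ψ₀) : Form 2) := fun σ j => by
    have hc (j : Fin 2 → Fin 7) : (Fin.cons b j : Fin 3 → Fin 7) = Fin.append ![b] j := by
      funext x
      fin_cases x <;> rfl
    rw [hX]
    simp only [hc]
    exact (isAntisymm_φ₀.append_right (k := 1) (l := 2) ![b]) σ j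
  refine (wedge_dx hX' a p q r).trans ?_
  rw [hX]
  rfl

/-- `iMap` on symmetric matrices, in terms of the cross product. -/
lemma iMap_apply {h : Matrix (Fin 7) (Fin 7) ℝ} (hs : h.IsSymm) (p q r : Fin 7) :
    iMap h ![p, q, r] = 2 * (crossSgn q r * h p (crossIdx q r)
      - crossSgn p r * h q (crossIdx p r) + crossSgn p q * h r (crossIdx p q)) := by
  have hY (Y : Fin 7 → Fin 7 → ℝ) :
      ∑ a, ∑ b, h a b * (Y a b + Y b a) = 2 * ∑ a, ∑ b, h a b * Y a b := by
    have : ∑ a, ∑ b, h a b * Y b a = ∑ a, ∑ b, h a b * Y a b := by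
      rw [sum_comm]
      exact sum_congr rfl fun a _ => sum_congr rfl fun b _ => by rw [hs.apply]
    simp only [mul_add, sum_add_distrib, this]
    ring
  have h1 : iMap h ![p, q, r] = ∑ a, ∑ b, h a b *
      (wedge (dx a) (hstar (wedge (dx b) ψ₀)) ![p, q, r] +
        wedge (dx b) (hstar (wedge (dx a) ψ₀)) ![p, q, r]) := by
    simp only [iMap, Finset.sum_apply, Pi.smul_apply, Pi.add_apply, smul_eq_mul]
  rw [h1, hY fun a b => wedge (dx a) (hstar (wedge (dx b) ψ₀)) ![p, q, r]]
  simp only [wedge_dx_hstar, φ₀_cross, mul_add, mul_sub, sum_add_distrib, sum_sub_distrib,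
    mul_ite, mul_zero, sum_ite_irrel, sum_const_zero, sum_ite_eq, sum_ite_eq', mem_univ, if_true]
  ring

lemma isAntisymm_iMap (h : Matrix (Fin 7) (Fin 7) ℝ) : IsAntisymm (iMap h) := fun σ i => by
  have hw (a b : Fin 7) : wedge (dx a) (hstar (wedge (dx b) ψ₀)) (i ∘ σ) =
      ((Perm.sign σ : ℤ) : ℝ) * wedge (dx a) (hstar (wedge (dx b) ψ₀)) i :=
    isAntisymm_wedge (dx a) (hstar (wedge (dx b) ψ₀)) σ i
  simp only [iMap, Finset.sum_apply, Pi.smul_apply, Pi.add_apply, smul_eq_mul, hw, mul_sum]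
  exact sum_congr rfl fun a _ => sum_congr rfl fun b _ => by ring

lemma IsAntisymm.ext {k : ℕ} {F G : Form k} (hF : IsAntisymm F) (hG : IsAntisymm G)
    (h : ∀ i : Fin k → Fin 7, StrictMono i → F i = G i) : F = G := by
  funext i
  by_cases hi : Function.Injective i
  · have hs := h (i ∘ Tuple.sort i)
      ((Tuple.monotone_sort i).strictMono_of_injective (hi.comp (Tuple.sort i).injective))
    rw [hF, hG] at hs
    have hne : ((Perm.sign (Tuple.sort i) : ℤ) : ℝ) ≠ 0 := fun h0 => by
      simpa [h0] using sign_mul_self (Tuple.sort i)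
    exact mul_left_cancel₀ hne hs
  · rw [hF.isAlt.1 i hi, hG.isAlt.1 i hi]

lemma wedge_ψ₀_eq_zero_iff_sum {γ : Form 3} (hγ : IsAntisymm γ) :
    wedge γ ψ₀ = 0 ↔ ∑ t, (φSgn t : ℝ) * γ (φIdx t) = 0 := by
  rw [wedge_ψ₀_eq_zero_iff, sum_φ₀_mul hγ]
  simp

lemma wedge_φ₀_eq_zero_iff_sum {γ : Form 3} (hγ : IsAntisymm γ) :
    wedge γ φ₀ = 0 ↔ ∀ c, ∑ t, (φSgn t : ℝ) * ∑ m : Fin 4,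
      (-1) ^ (m : ℕ) * (if ψIdx t m = c then 1 else 0) * γ (ψIdx t ∘ m.succAbove) = 0 := by
  rw [wedge_φ₀_eq_zero_iff]
  refine forall_congr' fun c => ?_
  have h (t : Fin 7) (m : Fin 4) : ∑ a, mono (ψIdx t ∘ m.succAbove) a * γ a =
      6 * γ (ψIdx t ∘ m.succAbove) := by
    rw [sum_mono_mul _ hγ]
    norm_num [Nat.factorial]
  have h' : ∑ a, γ a * ψ₀ (Fin.cons c a) = 6 * ∑ t, (φSgn t : ℝ) * ∑ m : Fin 4,
      (-1) ^ (m : ℕ) * (if ψIdx t m = c then 1 else 0) * γ (ψIdx t ∘ m.succAbove) := by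
    simp_rw [ψ₀_apply, mul_sum]
    rw [sum_comm]
    refine sum_congr rfl fun t _ => ?_
    simp_rw [mono_cons, mul_sum]
    rw [sum_comm]
    refine sum_congr rfl fun m _ => ?_
    rw [mul_left_comm 6, mul_left_comm 6, ← h, mul_sum, mul_sum]
    exact sum_congr rfl fun a _ => by ring
  rw [h']
  simp

/-- The inverse of `iMap` on its image. -/
noncomputable def recover (γ : Form 3) : Matrix (Fin 7) (Fin 7) ℝ := Matrix.of fun a b =>
  (1 / 16) * ∑ q, (crossSgn b q * γ ![a, q, crossIdx b q]
    + crossSgn a q * γ ![b, q, crossIdx a q])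

lemma recover_isSymm (γ : Form 3) : (recover γ).IsSymm := by
  ext a b
  simp only [recover, Matrix.transpose_apply, Matrix.of_apply, add_comm]

set_option maxHeartbeats 4000000 in
lemma recover_iMap {h : Matrix (Fin 7) (Fin 7) ℝ} (hs : h.IsSymm) (ht : h.trace = 0) :
    recover (iMap h) = h := by
  have hlt (a b : Fin 7) (_ : b < a) : h a b = h b a := hs.apply b a
  simp only [Matrix.trace, Matrix.diag_apply, Fin.sum_univ_seven] at ht
  ext a b
  simp only [recover, Matrix.of_apply, iMap_apply hs, Fin.sum_univ_seven]
  fin_cases a <;> fin_cases b <;>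
    simp [crossSgn, crossIdx, hlt] <;> linarith [hlt 1 0 (by decide)]

set_option maxHeartbeats 4000000 in
lemma wedge_iMap_φ₀ {h : Matrix (Fin 7) (Fin 7) ℝ} (hs : h.IsSymm) : wedge (iMap h) φ₀ = 0 := by
  rw [wedge_φ₀_eq_zero_iff_sum (isAntisymm_iMap h)]
  have hlt (a b : Fin 7) (_ : b < a) : h a b = h b a := hs.apply b a
  have hγ (t : Fin 7) (m : Fin 4) : iMap h (ψIdx t ∘ m.succAbove) =
      iMap h ![ψIdx t (m.succAbove 0), ψIdx t (m.succAbove 1), ψIdx t (m.succAbove 2)] := by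
    congr 1
    funext x
    fin_cases x <;> rfl
  simp only [hγ, iMap_apply hs, Fin.sum_univ_seven, Fin.sum_univ_four]
  intro c
  fin_cases c <;>
    simp [ψIdx, φSgn, crossSgn, crossIdx, Fin.succAbove, hlt] <;> ring

lemma wedge_iMap_ψ₀ {h : Matrix (Fin 7) (Fin 7) ℝ} (hs : h.IsSymm) (ht : h.trace = 0) :
    wedge (iMap h) ψ₀ = 0 := by
  rw [wedge_ψ₀_eq_zero_iff_sum (isAntisymm_iMap h)]
  simp only [Matrix.trace, Matrix.diag_apply, Fin.sum_univ_seven] at ht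
  simp only [φIdx, Fin.sum_univ_seven, Matrix.cons_val, iMap_apply hs]
  simp [φSgn, crossSgn, crossIdx]
  linarith

lemma IsAntisymm.apply_swap_left {γ : Form 3} (hγ : IsAntisymm γ) (a b c : Fin 7) :
    γ ![a, b, c] = -γ ![b, a, c] := by
  have h := hγ (swap 0 1) ![b, a, c]
  have hs : ![b, a, c] ∘ swap (0 : Fin 3) 1 = ![a, b, c] := by
    funext x
    fin_cases x <;> rfl
  rw [hs, Perm.sign_swap (by decide)] at h
  simpa using h

lemma IsAntisymm.apply_swap_right {γ : Form 3} (hγ : IsAntisymm γ) (a b c : Fin 7) :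
    γ ![a, b, c] = -γ ![a, c, b] := by
  have h := hγ (swap 1 2) ![a, c, b]
  have hs : ![a, c, b] ∘ swap (1 : Fin 3) 2 = ![a, b, c] := by
    funext x
    fin_cases x <;> rfl
  rw [hs, Perm.sign_swap (by decide)] at h
  simpa using h

/-- The content of `wedge γ φ₀ = 0` and `wedge γ ψ₀ = 0` for the coefficients `g` of `γ`, and the
antisymmetry of `γ` in a form suitable for sorting indices. -/
lemma exists_coeff {γ : Form 3} (hγ : IsAntisymm γ) (hφ : wedge γ φ₀ = 0) (hψ : wedge γ ψ₀ = 0) :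
    ∃ g : Fin 7 → Fin 7 → Fin 7 → ℝ, (∀ a b c, γ ![a, b, c] = g a b c) ∧
      (∀ a b c, b.val < a.val → g a b c = -g b a c) ∧
      (∀ a b c, c.val < b.val → g a b c = -g a c b) ∧
      (∀ a c, g a a c = 0) ∧ (∀ a b, g a b b = 0) ∧
      (∑ t, (φSgn t : ℝ) * g (φIdx t 0) (φIdx t 1) (φIdx t 2) = 0) ∧
      ∀ c, ∑ t, (φSgn t : ℝ) * ∑ m : Fin 4, (-1) ^ (m : ℕ) * (if ψIdx t m = c then 1 else 0) *
        g (ψIdx t (m.succAbove 0)) (ψIdx t (m.succAbove 1)) (ψIdx t (m.succAbove 2)) = 0 := by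
  have he (i : Fin 3 → Fin 7) : ![i 0, i 1, i 2] = i := by
    funext x
    fin_cases x <;> rfl
  refine ⟨fun a b c => γ ![a, b, c], fun _ _ _ => rfl, fun a b c _ => hγ.apply_swap_left a b c,
    fun a b c _ => hγ.apply_swap_right a b c, fun a c => ?_, fun a b => ?_, ?_, fun c => ?_⟩
  · have := hγ.apply_swap_left a a c
    linarith
  · have := hγ.apply_swap_right a b b
    linarith
  · simpa only [he] using (wedge_ψ₀_eq_zero_iff_sum hγ).1 hψ
  · have hi (t : Fin 7) (m : Fin 4) := he (ψIdx t ∘ m.succAbove)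
    simp only [Function.comp_apply] at hi
    simpa only [hi] using (wedge_φ₀_eq_zero_iff_sum hγ).1 hφ c

lemma recover_trace {γ : Form 3} (hγ : IsAntisymm γ) (hφ : wedge γ φ₀ = 0)
    (hψ : wedge γ ψ₀ = 0) : (recover γ).trace = 0 := by
  obtain ⟨g, hg, h01, h12, h00, h11, h, -⟩ := exists_coeff hγ hφ hψ
  simp only [Fin.sum_univ_seven, φIdx, φSgn, Matrix.cons_val] at h
  simp [h01, h12] at h
  simp only [Matrix.trace, Matrix.diag_apply, recover, Matrix.of_apply, hg, Fin.sum_univ_seven,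
    crossIdx, crossSgn, Matrix.cons_val]
  simp [h01, h12, h00, h11]
  linarith

set_option maxHeartbeats 4000000 in
lemma iMap_recover {γ : Form 3} (hγ : IsAntisymm γ) (hφ : wedge γ φ₀ = 0)
    (hψ : wedge γ ψ₀ = 0) : iMap (recover γ) = γ := by
  obtain ⟨g, hg, h01, h12, h00, h11, h, hc⟩ := exists_coeff hγ hφ hψ
  simp only [Fin.sum_univ_seven, φIdx, φSgn, Matrix.cons_val] at h
  simp [h01, h12] at h
  have hc0 := hc 0
  have hc1 := hc 1
  have hc2 := hc 2
  have hc3 := hc 3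
  have hc4 := hc 4
  have hc5 := hc 5
  have hc6 := hc 6
  simp [Fin.sum_univ_seven, Fin.sum_univ_four, ψIdx, φSgn, Fin.succAbove, h12]
    at hc0 hc1 hc2 hc3 hc4 hc5 hc6
  have key (p q r : Fin 7) : p < q → q < r → iMap (recover γ) ![p, q, r] = g p q r := by
    rw [iMap_apply (recover_isSymm γ)]
    simp only [recover, Matrix.of_apply, hg, Fin.sum_univ_seven]
    fin_cases p <;> fin_cases q <;> first
      | exact fun hlt => absurd hlt (by decide)
      | intro _
        fin_cases r <;> first
          | exact fun hlt => absurd hlt (by decide)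
          | intro _
            simp [crossIdx, crossSgn, h01, h12, h00, h11]
            linarith
  refine (isAntisymm_iMap _).ext hγ fun i hi => ?_
  have he : i = ![i 0, i 1, i 2] := by
    funext x
    fin_cases x <;> rfl
  rw [he, hg]
  exact key _ _ _ (hi (by decide)) (hi (by decide))

end G2R7

/-- i maps the 27-dimensional space of traceless symmetric bilinear
forms injectively into Λ³, with image exactly Λ³₂₇ = {γ : γ∧φ₀ = 0, γ∧ψ₀ = 0}. -/
theorem stmt19 :
    (∀ h₁ h₂ : Matrix (Fin 7) (Fin 7) ℝ,
      h₁.IsSymm → Matrix.trace h₁ = 0 → h₂.IsSymm → Matrix.trace h₂ = 0 →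
      iMap h₁ = iMap h₂ → h₁ = h₂) ∧
    iMap '' {h : Matrix (Fin 7) (Fin 7) ℝ | h.IsSymm ∧ Matrix.trace h = 0}
      = {γ : Form 3 | IsAlt γ ∧ wedge γ φ₀ = 0 ∧ wedge γ ψ₀ = 0} := by
  refine ⟨fun h₁ h₂ hs₁ ht₁ hs₂ ht₂ h => ?_, ?_⟩
  · rw [← recover_iMap hs₁ ht₁, h, recover_iMap hs₂ ht₂]
  · ext γ
    constructor
    · rintro ⟨h, ⟨hs, ht⟩, rfl⟩
      exact ⟨(isAntisymm_iMap h).isAlt, wedge_iMap_φ₀ hs, wedge_iMap_ψ₀ hs ht⟩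
    · rintro ⟨hγ, hφ, hψ⟩
      exact ⟨recover γ, ⟨recover_isSymm γ, recover_trace hγ.2 hφ hψ⟩, iMap_recover hγ.2 hφ hψ⟩
end
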